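/- The Apéry constant satisfies $\zeta(3) = \frac{1}{7} \sum_{k=1}^{\infty} \frac{H_{k-1}\, 4^k}{k^2 \binom{2k}{k}}$, and for every positive integer $n$, $\sum_{k=1}^{\infty} \frac{H_{k-1}}{k^2 \binom{n+k}{k}} = \zeta(3) - H_n^{(3)}$. -/

import Mathlib

/-- The `n`-th harmonic number `H_n = ∑_{k=1}^n 1/k`, with `H_0 = 0`. -/
noncomputable def H (n : ℕ) : ℝ := ∑ i ∈ Finset.range n, (1 : ℝ) / (i + 1)

/-- The generalized harmonic number of order 3, `H_n^{(3)} = ∑_{k=1}^n 1/k³`. -/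
noncomputable def H3 (n : ℕ) : ℝ := ∑ i ∈ Finset.range n, (1 : ℝ) / (i + 1) ^ 3

/-- `ζ(3) = ∑_{k=1}^∞ 1/k³`, the value of the Riemann zeta function at 3
(the Apéry constant). -/
noncomputable def zeta3 : ℝ := ∑' k : ℕ, (1 : ℝ) / ((k : ℝ) + 1) ^ 3

open Filter Topology

noncomputable def BB (n : ℕ) (x : ℝ) : ℝ := ∏ i ∈ Finset.range n, (x + i + 1) / (i + 1)

noncomputable def aa (k : ℕ) (x : ℝ) : ℝ := H k / (((k : ℝ) + 1) ^ 2 * BB (k + 1) x)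

noncomputable def TT (k : ℕ) (x : ℝ) : ℝ :=
  (H k / (x + 1) + 1 / (x + 1) ^ 2) / (((k : ℝ) + 1) * BB (k + 1) x)

lemma BB_succ (n : ℕ) (x : ℝ) : BB (n + 1) x = BB n x * ((x + n + 1) / (n + 1)) := by
  rw [BB, Finset.prod_range_succ, BB]

lemma H_succ (n : ℕ) : H (n + 1) = H n + 1 / ((n : ℝ) + 1) := by
  simp [H, Finset.sum_range_succ]

lemma H_nonneg (n : ℕ) : 0 ≤ H n := Finset.sum_nonneg fun i _ => by positivity

lemma BB_pos (n : ℕ) (x : ℝ) (hx : -1 / 2 ≤ x) : 0 < BB n x := by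
  refine Finset.prod_pos fun i _ => ?_
  have : (0 : ℝ) ≤ i := by positivity
  apply div_pos <;> linarith

lemma BB_shift (n : ℕ) (x : ℝ) : BB n (x + 1) * (x + 1) = BB n x * (x + n + 1) := by
  induction n with
  | zero => simp [BB]
  | succ n ih =>
    rw [BB_succ, BB_succ]
    have h : (n : ℝ) + 1 ≠ 0 := by positivity
    push_cast
    calc _ = (BB n (x + 1) * (x + 1)) * ((x + 1 + n + 1) / (n + 1)) := by ring
      _ = _ := by rw [ih]; ring

lemma BB_lower (n : ℕ) (x : ℝ) (hx : -1 / 2 ≤ x) : 1 / 4 ≤ ((n : ℝ) + 1) * BB (n + 1) x ^ 2 := by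
  induction n with
  | zero => simp [BB]; nlinarith
  | succ n ih =>
    rw [BB_succ]
    push_cast
    set b := BB (n + 1) x
    have hn : (0 : ℝ) ≤ n := by positivity
    have h1 : (n : ℝ) + 1 ≤ ((n : ℝ) + 1 + 1) * ((x + (n + 1) + 1) / (n + 1 + 1)) ^ 2 := by
      have : ((n : ℝ) + 1 + 1) * ((x + (n + 1) + 1) / (n + 1 + 1)) ^ 2
        = (x + (n + 1) + 1) ^ 2 / (n + 1 + 1) := by field_simp
      rw [this, le_div_iff₀ (by positivity)]
      nlinarith
    nlinarith [mul_le_mul_of_nonneg_right h1 (sq_nonneg b)]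

lemma aa_nonneg (k : ℕ) (x : ℝ) (hx : -1 / 2 ≤ x) : 0 ≤ aa k x := by
  have := BB_pos (k + 1) x hx
  have := H_nonneg k
  unfold aa; positivity

lemma TT_nonneg (k : ℕ) (x : ℝ) (hx : -1 / 2 ≤ x) : 0 ≤ TT k x := by
  have := BB_pos (k + 1) x hx
  have := H_nonneg k
  have : 0 < x + 1 := by linarith
  unfold TT; positivity

lemma aa_diff (k : ℕ) (x : ℝ) (hx : -1 / 2 ≤ x) :
    aa k x - aa k (x + 1) = TT k x - TT (k + 1) x := by
  have hb := BB_pos (k + 1) x hx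
  have hs := BB_shift (k + 1) x
  have hx1 : 0 < x + 1 := by linarith
  have hk : (0 : ℝ) ≤ k := by positivity
  have hxk : 0 < x + (k + 1) + 1 := by linarith
  have e : BB (k + 1) (x + 1) = BB (k + 1) x * (x + (k + 1) + 1) / (x + 1) := by
    rw [eq_div_iff hx1.ne', hs]; push_cast; ring
  unfold aa TT
  rw [e, BB_succ (k + 1), H_succ]
  push_cast
  field_simp
  ring

lemma aa_diff_nonneg (k : ℕ) (x : ℝ) (hx : -1 / 2 ≤ x) : aa k (x + 1) ≤ aa k x := by
  have hb := BB_pos (k + 1) x hx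
  have hs := BB_shift (k + 1) x
  have hx1 : 0 < x + 1 := by linarith
  have hk : (0 : ℝ) ≤ k := by positivity
  have : BB (k + 1) x ≤ BB (k + 1) (x + 1) := by
    push_cast at hs
    refine le_of_mul_le_mul_right ?_ hx1
    rw [hs]; nlinarith
  have := H_nonneg k
  unfold aa
  gcongr

lemma TT_zero (x : ℝ) : TT 0 x = 1 / (x + 1) ^ 3 := by
  simp [TT, BB, H]
  rw [div_eq_mul_inv, ← mul_inv, ← pow_succ]

lemma TT_le (k : ℕ) (x : ℝ) (hx : -1 / 2 ≤ x) : TT k x ≤ 1 / (x + 1) ^ 3 := by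
  induction k with
  | zero => rw [TT_zero]
  | succ k ih => linarith [aa_diff k x hx, aa_diff_nonneg k x hx]

lemma H_tendsto : Tendsto (fun k : ℕ => (2 * H k + 4) * (2 / √((k : ℝ) + 1))) atTop (𝓝 0) := by
  have hlog : Tendsto (fun x : ℝ => Real.log x / x ^ (1 / 2 : ℝ)) atTop (𝓝 0) :=
    (isLittleO_log_rpow_atTop (by norm_num : (0 : ℝ) < 1 / 2)).tendsto_div_nhds_zero
  have hc : Tendsto (fun k : ℕ => (k : ℝ) + 1) atTop atTop :=
    tendsto_atTop_add_const_right _ _ tendsto_natCast_atTop_atTop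
  have h1 := hlog.comp hc
  have h2 : Tendsto (fun k : ℕ => (√((k : ℝ) + 1))⁻¹) atTop (𝓝 0) :=
    tendsto_inv_atTop_zero.comp (Real.tendsto_sqrt_atTop.comp hc)
  have h3 := (h1.const_mul 4).add (h2.const_mul 12)
  simp only [mul_zero, add_zero] at h3
  refine squeeze_zero (fun k => ?_) (fun k => ?_) h3
  · have := H_nonneg k; positivity
  · have hH : H k ≤ 1 + Real.log ((k : ℝ) + 1) := by
      have e : H k = (harmonic k : ℝ) := by simp [H, harmonic]
      rw [e]
      refine (harmonic_le_one_add_log k).trans ?_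
      rcases Nat.eq_zero_or_pos k with h | h
      · simp [h]
      · have : (0 : ℝ) < k := by exact_mod_cast h
        gcongr; linarith
    have hs : 0 < √((k : ℝ) + 1) := by positivity
    simp only [Function.comp, ← Real.sqrt_eq_rpow]
    have : 4 * (Real.log ((k : ℝ) + 1) / √((k : ℝ) + 1)) + 12 * (√((k : ℝ) + 1))⁻¹
      = (2 * (1 + Real.log ((k : ℝ) + 1)) + 4) * (2 / √((k : ℝ) + 1)) := by
      field_simp; ring
    rw [this]
    gcongr

lemma TT_tendsto (x : ℝ) (hx : -1 / 2 ≤ x) : Tendsto (fun k => TT k x) atTop (𝓝 0) := by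
  refine squeeze_zero (fun k => TT_nonneg k x hx) (fun k => ?_) H_tendsto
  have hb := BB_pos (k + 1) x hx
  have hl := BB_lower k x hx
  have hH := H_nonneg k
  have hx1 : 1 / 2 ≤ x + 1 := by linarith
  have hs : 0 < √((k : ℝ) + 1) := by positivity
  have hs2 : √((k : ℝ) + 1) ^ 2 = (k : ℝ) + 1 := Real.sq_sqrt (by positivity)
  have h1 : 1 / 2 ≤ √((k : ℝ) + 1) * BB (k + 1) x := by
    refine le_of_sq_le_sq ?_ (by positivity)
    rw [mul_pow, hs2]; linarith
  have h2 : √((k : ℝ) + 1) / 2 ≤ ((k : ℝ) + 1) * BB (k + 1) x := by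
    have := mul_le_mul_of_nonneg_left h1 hs.le
    calc _ = √((k : ℝ) + 1) * (1 / 2) := by ring
      _ ≤ _ := this
      _ = √((k : ℝ) + 1) ^ 2 * BB (k + 1) x := by ring
      _ = _ := by rw [hs2]
  have h3 : H k / (x + 1) + 1 / (x + 1) ^ 2 ≤ 2 * H k + 4 := by
    have : H k / (x + 1) ≤ H k / (1 / 2) := by gcongr
    have : 1 / (x + 1) ^ 2 ≤ 1 / (1 / 2 : ℝ) ^ 2 := by gcongr
    norm_num at *
    linarith
  unfold TT
  rw [div_eq_mul_inv]
  have h4 : (((k : ℝ) + 1) * BB (k + 1) x)⁻¹ ≤ 2 / √((k : ℝ) + 1) := by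
    rw [← inv_div]
    gcongr
  gcongr

lemma sum_cubes (x : ℝ) (hx : -1 / 2 ≤ x) :
    Summable (fun j : ℕ => 1 / (x + j + 1) ^ 3) := by
  have h : Summable (fun j : ℕ => (1 : ℝ) / ((j : ℝ)) ^ 3) :=
    Real.summable_one_div_nat_pow.2 (by norm_num)
  have h1 := ((summable_nat_add_iff 1).2 h).mul_left 8
  refine Summable.of_nonneg_of_le (fun j => ?_) (fun j => ?_) h1
  · have : (0 : ℝ) ≤ j := by positivity
    have : 0 < x + j + 1 := by linarith
    positivity
  · have hj : (0 : ℝ) ≤ j := by positivity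
    have : ((j : ℝ) + 1) / 2 ≤ x + j + 1 := by linarith
    calc 1 / (x + j + 1) ^ 3 ≤ 1 / (((j : ℝ) + 1) / 2) ^ 3 := by gcongr
      _ = _ := by push_cast; field_simp; norm_num

lemma aa_tendsto (k : ℕ) (x : ℝ) (hx : -1 / 2 ≤ x) :
    Tendsto (fun N : ℕ => aa k (x + N)) atTop (𝓝 0) := by
  have hge : ∀ N : ℕ, -1 / 2 ≤ x + N := fun N => by
    have : (0 : ℝ) ≤ N := by positivity
    linarith
  -- the differences are bounded by `1/(x+N+1)`-type terms
  have hB : ∀ N : ℕ, (x + N + 1) * BB (k + 1) 0 / 2 ^ k ≤ BB (k + 1) (x + N) := by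
    intro N
    have hN := hge N
    set y := x + N
    clear_value y
    have h0 : BB (k + 1) 0 = 1 := by
      unfold BB
      refine Finset.prod_eq_one fun i _ => ?_
      have : (i : ℝ) + 1 ≠ 0 := by positivity
      field_simp; ring
    rw [h0, mul_one]
    induction k with
    | zero => simp [BB]
    | succ k ih =>
      have h0' : BB (k + 1) 0 = 1 := by
        unfold BB
        refine Finset.prod_eq_one fun i _ => ?_
        have : (i : ℝ) + 1 ≠ 0 := by positivity
        field_simp; ring
      have ih := ih h0'
      rw [BB_succ]
      have hk : (0 : ℝ) ≤ k := by positivity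
      have : (1 / 2 : ℝ) ≤ (y + ((k + 1 : ℕ) : ℝ) + 1) / (((k + 1 : ℕ) : ℝ) + 1) := by
        push_cast
        rw [le_div_iff₀ (by positivity)]; linarith
      calc (y + 1) / 2 ^ (k + 1) = (y + 1) / 2 ^ k * (1 / 2) := by rw [pow_succ]; field_simp
        _ ≤ _ := by
          have := BB_pos (k + 1) y hN
          gcongr
  have h0 : 0 < BB (k + 1) 0 := BB_pos _ _ (by norm_num)
  have hc : Tendsto (fun N : ℕ => (x + N + 1)) atTop atTop :=
    tendsto_atTop_add_const_right _ _ (tendsto_atTop_add_const_left _ _ tendsto_natCast_atTop_atTop)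
  have hBt : Tendsto (fun N : ℕ => BB (k + 1) (x + N)) atTop atTop := by
    refine tendsto_atTop_mono hB ?_
    have := hc.atTop_mul_const (show 0 < BB (k + 1) 0 / 2 ^ k by positivity)
    simpa [mul_div_assoc] using this
  unfold aa
  exact tendsto_const_nhds.div_atTop (hBt.const_mul_atTop (by positivity))

lemma hasSum_K (K : ℕ) (x : ℝ) (hx : -1 / 2 ≤ x) :
    HasSum (fun j : ℕ => 1 / (x + j + 1) ^ 3 - TT K (x + j)) (∑ k ∈ Finset.range K, aa k x) := by
  have hge : ∀ N : ℕ, -1 / 2 ≤ x + N := fun N => by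
    have : (0 : ℝ) ≤ N := by positivity
    linarith
  rw [hasSum_iff_tendsto_nat_of_nonneg
    (fun j => sub_nonneg.2 (TT_le K (x + j) (hge j)))]
  have key : ∀ N : ℕ, ∑ j ∈ Finset.range N, (1 / (x + j + 1) ^ 3 - TT K (x + j))
      = ∑ k ∈ Finset.range K, (aa k x - aa k (x + N)) := by
    intro N
    induction N with
    | zero => simp
    | succ N ih =>
      rw [Finset.sum_range_succ, ih, ← TT_zero, ← Finset.sum_range_sub' (fun k => TT k (x + N)),
        ← Finset.sum_add_distrib]
      refine Finset.sum_congr rfl fun k _ => ?_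
      rw [← aa_diff k _ (hge N)]
      push_cast
      rw [add_assoc x]; ring
  simp_rw [key]
  refine tendsto_finsetSum _ fun k _ => ?_
  simpa using tendsto_const_nhds.sub (aa_tendsto k x hx)

lemma main_sum (x : ℝ) (hx : -1 / 2 ≤ x) :
    ∑' k, aa k x = ∑' j : ℕ, 1 / (x + j + 1) ^ 3 := by
  have hge : ∀ N : ℕ, -1 / 2 ≤ x + N := fun N => by
    have : (0 : ℝ) ≤ N := by positivity
    linarith
  have hs := sum_cubes x hx
  refine HasSum.tsum_eq ?_
  rw [hasSum_iff_tendsto_nat_of_nonneg (fun k => aa_nonneg k x hx)]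
  have e : (fun K => ∑ k ∈ Finset.range K, aa k x)
      = fun K => ∑' j : ℕ, (1 / (x + j + 1) ^ 3 - TT K (x + j)) :=
    funext fun K => (hasSum_K K x hx).tsum_eq.symm
  rw [e]
  refine tendsto_tsum_of_dominated_convergence hs (fun j => ?_) (Eventually.of_forall fun K j => ?_)
  · simpa using tendsto_const_nhds.sub (TT_tendsto (x + j) (hge j))
  · rw [Real.norm_eq_abs, abs_of_nonneg (sub_nonneg.2 (TT_le K (x + j) (hge j)))]
    linarith [TT_nonneg K (x + j) (hge j)]

lemma BB_nat (n k : ℕ) : BB k n = (Nat.choose (n + k) k : ℝ) := by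
  induction k with
  | zero => simp [BB]
  | succ k ih =>
    rw [BB_succ, ih, ← mul_div_assoc, div_eq_iff (by positivity)]
    have := Nat.add_one_mul_choose_eq (n + k) k
    have h : ((n : ℝ) + k + 1) * (n + k).choose k = (n + k + 1).choose (k + 1) * ((k : ℝ) + 1) := by
      exact_mod_cast this
    rw [← add_assoc, ← h]; ring

lemma BB_half (k : ℕ) : BB k (-1 / 2) * 4 ^ k = (Nat.choose (2 * k) k : ℝ) := by
  induction k with
  | zero => simp [BB]
  | succ k ih =>
    have := Nat.succ_mul_centralBinom_succ k
    simp only [Nat.centralBinom] at this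
    have h : ((k : ℝ) + 1) * (2 * (k + 1)).choose (k + 1)
        = 2 * (2 * (k : ℝ) + 1) * (2 * k).choose k := by exact_mod_cast this
    have hk : (k : ℝ) + 1 ≠ 0 := by positivity
    apply mul_left_cancel₀ hk
    rw [h, ← ih, BB_succ, pow_succ]
    field_simp
    ring

theorem apery_series_and_harmonic_binom :
    (zeta3 = 1 / 7 *
      ∑' k : ℕ,
        H k * 4 ^ (k + 1) / (((k : ℝ) + 1) ^ 2 * (Nat.choose (2 * (k + 1)) (k + 1) : ℝ))) ∧
    ∀ n : ℕ, 0 < n →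
      ∑' k : ℕ, H k / (((k : ℝ) + 1) ^ 2 * (Nat.choose (n + (k + 1)) (k + 1) : ℝ)) =
        zeta3 - H3 n := by
  have hz : Summable (fun j : ℕ => (1 : ℝ) / ((j : ℝ) + 1) ^ 3) := by
    simpa using sum_cubes 0 (by norm_num)
  constructor
  · have e : ∀ k : ℕ, H k * 4 ^ (k + 1) /
        (((k : ℝ) + 1) ^ 2 * (Nat.choose (2 * (k + 1)) (k + 1) : ℝ)) = aa k (-1 / 2) := by
      intro k
      have := BB_pos (k + 1) (-1 / 2) le_rfl
      rw [← BB_half, aa]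
      field_simp
    simp_rw [e]
    rw [main_sum _ le_rfl]
    have ho : ∀ j : ℕ, (1 : ℝ) / (-1 / 2 + j + 1) ^ 3 = 8 * (1 / (((2 * j : ℕ) : ℝ) + 1) ^ 3) := by
      intro j
      have h1 : (-1 / 2 + (j : ℝ) + 1) = (2 * j + 1) / 2 := by ring
      rw [h1]; push_cast
      field_simp; norm_num
    have hev : ∀ j : ℕ, (1 : ℝ) / (((2 * j + 1 : ℕ) : ℝ) + 1) ^ 3
        = 1 / 8 * (1 / ((j : ℝ) + 1) ^ 3) := by
      intro j
      have h1 : (((2 * j + 1 : ℕ) : ℝ) + 1) = 2 * (j + 1) := by push_cast; ring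
      rw [h1, mul_pow]
      field_simp; norm_num
    have hsp := tsum_even_add_odd (f := fun j : ℕ => (1 : ℝ) / ((j : ℝ) + 1) ^ 3)
      (hz.comp_injective (i := fun k => 2 * k) (fun a b h => by simpa using h))
      (hz.comp_injective (i := fun k => 2 * k + 1) (fun a b h => by simpa using h))
    simp_rw [hev] at hsp
    simp_rw [ho]
    rw [tsum_mul_left] at hsp ⊢
    change _ + 1 / 8 * zeta3 = zeta3 at hsp
    linarith
  · intro n _
    have e : ∀ k : ℕ, H k / (((k : ℝ) + 1) ^ 2 * (Nat.choose (n + (k + 1)) (k + 1) : ℝ))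
        = aa k n := by
      intro k
      rw [aa, BB_nat]
    simp_rw [e]
    have hn : (0 : ℝ) ≤ n := by positivity
    rw [main_sum _ (by linarith)]
    have := hz.sum_add_tsum_nat_add n
    unfold zeta3 H3
    rw [← this]
    simp only [add_sub_cancel_left]
    refine tsum_congr fun j => ?_
    push_cast
    rw [add_comm (n : ℝ)]
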